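/- With the setup parameters δ = 10⁻¹² and sin φ = 10⁻⁴, let Γ be a segment barrier for the unit square U with total length L ≤ 2 + δ, partitioned into the almost horizontal segments X, the almost vertical segments Y, and the remaining segments Z. Then |Z| ≤ 2 · 10⁸ · δ = 2 · 10⁻⁴ = 2 sin φ. -/

import Mathlib

open MeasureTheory Set

noncomputable section

/-- A point in the plane. -/
abbrev Pt : Type := EuclideanSpace ℝ (Fin 2)

/-- A line in ℝ² is a set {p + t • v : t ∈ ℝ} for some p, v with v ≠ 0. -/
def IsLine (l : Set Pt) : Prop :=
  ∃ p v : Pt, v ≠ 0 ∧ l = {q : Pt | ∃ t : ℝ, q = p + t • v}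

/-- Γ is a barrier (opaque set) for C if every line meeting C also meets Γ. -/
def IsBarrier (Γ C : Set Pt) : Prop :=
  ∀ l : Set Pt, IsLine l → (l ∩ C).Nonempty → (l ∩ Γ).Nonempty

/-- The closed unit square U = [0,1] × [0,1]. -/
def unitSquare : Set Pt := {p : Pt | p 0 ∈ Icc (0:ℝ) 1 ∧ p 1 ∈ Icc (0:ℝ) 1}

/-- A segment [a, b] is almost horizontal if its direction makes angle at most
φ = arcsin 10⁻⁴ with the x-axis, i.e. |(b − a)₂| ≤ 10⁻⁴ ‖b − a‖. -/
def AlmostHorizontal (a b : Pt) : Prop := |(b - a) 1| ≤ 10 ^ (-4 : ℤ) * ‖b - a‖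

/-- A segment [a, b] is almost vertical if its direction makes angle at most
φ = arcsin 10⁻⁴ with the y-axis, i.e. |(b − a)₁| ≤ 10⁻⁴ ‖b − a‖. -/
def AlmostVertical (a b : Pt) : Prop := |(b - a) 0| ≤ 10 ^ (-4 : ℤ) * ‖b - a‖


lemma proj_cover (a b : ℕ → Pt) (s c0 : ℝ)
    (hbar : IsBarrier (⋃ i, segment ℝ (a i) (b i)) unitSquare)
    (hU : ∀ c ∈ Icc c0 (c0 + 2), ∃ q ∈ unitSquare, q 0 + s * q 1 = c)
    (hs : Summable fun i => |(b i - a i) 0 + s * (b i - a i) 1|) :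
    2 ≤ ∑' i, |(b i - a i) 0 + s * (b i - a i) 1| := by
  have hcov : Icc c0 (c0 + 2) ⊆
      ⋃ i, uIcc (a i 0 + s * a i 1) (b i 0 + s * b i 1) := by
    intro c hc
    obtain ⟨q, hq, hqc⟩ := hU c hc
    have hv : (!₂[-s, 1] : Pt) ≠ 0 := by
      intro h
      have := congrArg (fun p : Pt => p 1) h
      simp at this
    obtain ⟨r, ⟨t, ht⟩, hr⟩ := hbar {r | ∃ t : ℝ, r = q + t • (!₂[-s, 1] : Pt)}
      ⟨q, _, hv, rfl⟩ ⟨q, ⟨0, by simp⟩, hq⟩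
    have hrc : r 0 + s * r 1 = c := by
      rw [ht, ← hqc]; simp; ring
    obtain ⟨i, hi⟩ := mem_iUnion.1 hr
    refine mem_iUnion.2 ⟨i, ?_⟩
    obtain ⟨x, y, hx, hy, hxy, rfl⟩ := hi
    rw [← segment_eq_uIcc]
    refine ⟨x, y, hx, hy, hxy, ?_⟩
    rw [← hrc]; simp; ring
  have h1 := (measure_mono hcov).trans (measure_iUnion_le (μ := volume) _)
  have h2 : ∀ i, volume (uIcc (a i 0 + s * a i 1) (b i 0 + s * b i 1)) =
      ENNReal.ofReal |(b i - a i) 0 + s * (b i - a i) 1| := by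
    intro i
    rw [Real.volume_interval]
    congr 2
    simp; ring
  simp_rw [h2] at h1
  rw [← ENNReal.ofReal_tsum_of_nonneg (fun i => abs_nonneg _) hs, Real.volume_Icc] at h1
  have h3 := (ENNReal.ofReal_le_ofReal_iff (tsum_nonneg fun i => abs_nonneg _)).1 h1
  linarith

lemma norm_sq_pt (p : Pt) : ‖p‖ ^ 2 = p 0 ^ 2 + p 1 ^ 2 := by
  rw [EuclideanSpace.norm_sq_eq]; simp

/-- Lemma 3: for a segment barrier of the unit square of total length
at most 2 + δ (δ = 10⁻¹²), the total length of the segments that are neither almost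
horizontal nor almost vertical is at most 2·10⁸·δ = 2·10⁻⁴. -/
theorem Z_length_small
    (a b : ℕ → Pt) (hab : ∀ i, a i ≠ b i)
    (hbar : IsBarrier (⋃ i, segment ℝ (a i) (b i)) unitSquare)
    (hsum : Summable fun i => ‖b i - a i‖)
    (hL : ∑' i, ‖b i - a i‖ ≤ 2 + 10 ^ (-12 : ℤ)) :
    ∑' i : {j : ℕ // ¬ AlmostHorizontal (a j) (b j) ∧ ¬ AlmostVertical (a j) (b j)},
        ‖b i.1 - a i.1‖ ≤ 2 * 10 ^ (-4 : ℤ) := by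
  have hn : ∀ p : Pt, |p 0| ≤ ‖p‖ ∧ |p 1| ≤ ‖p‖ := fun p =>
    ⟨abs_le_of_sq_le_sq (by nlinarith [norm_sq_pt p, sq_nonneg (p 1)]) (norm_nonneg _),
     abs_le_of_sq_le_sq (by nlinarith [norm_sq_pt p, sq_nonneg (p 0)]) (norm_nonneg _)⟩
  have hs1 : Summable fun i => |(b i - a i) 0 + 1 * (b i - a i) 1| := by
    refine Summable.of_nonneg_of_le (fun i => abs_nonneg _) (fun i => ?_) (hsum.mul_left 2)
    rw [one_mul]
    linarith [abs_add_le ((b i - a i) 0) ((b i - a i) 1), (hn (b i - a i)).1, (hn (b i - a i)).2]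
  have hs2 : Summable fun i => |(b i - a i) 0 + (-1) * (b i - a i) 1| := by
    refine Summable.of_nonneg_of_le (fun i => abs_nonneg _) (fun i => ?_) (hsum.mul_left 2)
    have := abs_add_le ((b i - a i) 0) (-1 * (b i - a i) 1)
    rw [abs_mul, abs_neg, abs_one, one_mul] at this
    linarith [(hn (b i - a i)).1, (hn (b i - a i)).2]
  have h1 := proj_cover a b 1 0 hbar (by
    rintro c ⟨hc0, hc1⟩
    refine ⟨!₂[c / 2, c / 2], ⟨⟨?_, ?_⟩, ?_, ?_⟩, ?_⟩ <;> simp <;> linarith) hs1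
  have h2 := proj_cover a b (-1) (-1) hbar (by
    rintro c ⟨hc0, hc1⟩
    refine ⟨!₂[(1 + c) / 2, (1 - c) / 2], ⟨⟨?_, ?_⟩, ?_, ?_⟩, ?_⟩ <;> simp <;> linarith) hs2
  -- the deficit of each segment
  let d : ℕ → ℝ := fun i => ‖b i - a i‖ - (|(b i - a i) 0 + 1 * (b i - a i) 1| +
    |(b i - a i) 0 + (-1) * (b i - a i) 1|) / 2
  have hds : Summable d := hsum.sub ((hs1.add hs2).div_const 2)
  have hdt : ∑' i, d i ≤ 10 ^ (-12 : ℤ) := by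
    have e : ∑' i, d i = _ := hsum.tsum_sub ((hs1.add hs2).div_const 2)
    rw [e, tsum_div_const, hs1.tsum_add hs2]
    clear e
    revert h1 h2 hL
    generalize (∑' i, |(b i - a i) 0 + 1 * (b i - a i) 1|) = A
    generalize (∑' i, |(b i - a i) 0 + (-1) * (b i - a i) 1|) = B
    generalize (∑' i, ‖b i - a i‖) = C
    generalize (10 ^ (-12 : ℤ) : ℝ) = D
    intro hL h1 h2
    linarith
  have hmax : ∀ x y : ℝ, (|x + 1 * y| + |x + (-1) * y|) / 2 = |x| ∧ |y| ≤ |x| ∨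
      (|x + 1 * y| + |x + (-1) * y|) / 2 = |y| ∧ |x| ≤ |y| := by
    intro x y
    rcases abs_cases (x + 1 * y) with h | h <;> rcases abs_cases (x + (-1) * y) with h' | h' <;>
    rcases abs_cases x with k | k <;> rcases abs_cases y with k' | k' <;>
    first
    | (left; constructor <;> linarith)
    | (right; constructor <;> linarith)
  have hd0 : ∀ i, 0 ≤ d i := by
    intro i
    have := hn (b i - a i)
    rcases hmax ((b i - a i) 0) ((b i - a i) 1) with h | h <;> simp only [d, h.1] <;> linarith
  have key : ∀ l m M : ℝ, 0 ≤ m → 0 ≤ M → M ≤ l → l ^ 2 = m ^ 2 + M ^ 2 →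
      10 ^ (-4 : ℤ) * l < m → l ≤ 2 * 10 ^ 8 * (l - M) := by
    intro l m M hm hM hMl hl hlm
    have hl0 : 0 ≤ l := hM.trans hMl
    rcases hl0.eq_or_lt with h | h
    · subst h; linarith
    have h3 : (10 ^ (-4 : ℤ) * l) ^ 2 ≤ m ^ 2 := by gcongr
    have h4 : l ^ 2 ≤ 10 ^ 8 * ((l - M) * (l + M)) := by
      norm_num at h3 ⊢
      nlinarith
    have h5 : (l - M) * (l + M) ≤ (l - M) * (2 * l) := by
      apply mul_le_mul_of_nonneg_left <;> linarith
    nlinarith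
  have hZ : ∀ i : {j : ℕ // ¬ AlmostHorizontal (a j) (b j) ∧ ¬ AlmostVertical (a j) (b j)},
      ‖b i.1 - a i.1‖ ≤ 2 * 10 ^ 8 * d i.1 := by
    rintro ⟨i, hh, hv⟩
    simp only [AlmostHorizontal, AlmostVertical, not_le] at hh hv
    have h3 := hn (b i - a i)
    have h4 := norm_sq_pt (b i - a i)
    rw [← sq_abs ((b i - a i) 0), ← sq_abs ((b i - a i) 1)] at h4
    rcases hmax ((b i - a i) 0) ((b i - a i) 1) with h | h <;> simp only [d, h.1]
    · exact key _ _ _ (abs_nonneg _) (abs_nonneg _) h3.1 (by linarith) hh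
    · exact key _ _ _ (abs_nonneg _) (abs_nonneg _) h3.2 (by linarith) hv
  have hdsub : Summable fun i : {j : ℕ // ¬ AlmostHorizontal (a j) (b j) ∧
      ¬ AlmostVertical (a j) (b j)} => d i.1 := hds.subtype _
  calc _ ≤ ∑' i : {j : ℕ // ¬ AlmostHorizontal (a j) (b j) ∧ ¬ AlmostVertical (a j) (b j)},
        2 * 10 ^ 8 * d i.1 := (hsum.subtype _).tsum_le_tsum hZ (hdsub.mul_left _)
    _ = 2 * 10 ^ 8 * ∑' i : {j : ℕ // ¬ AlmostHorizontal (a j) (b j) ∧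
        ¬ AlmostVertical (a j) (b j)}, d i.1 := tsum_mul_left
    _ ≤ 2 * 10 ^ 8 * ∑' i, d i := by
        gcongr
        exact Summable.tsum_subtype_le d _ hd0 hds
    _ ≤ 2 * 10 ^ 8 * 10 ^ (-12 : ℤ) := by gcongr
    _ = _ := by norm_num
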